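/- Let μ, λ : Fin 5 → ℝ be two weights of length 5 (i.e. 0 < μⱼ < 1 and 0 < λⱼ < 1 for all j, and ∑ⱼ μⱼ = ∑ⱼ λⱼ = 2). If the multiset of the ten pairwise sums {μⱼ + μᵢ : 1 ≤ j < i ≤ 5} equals the multiset {λⱼ + λᵢ : 1 ≤ j < i ≤ 5}, then there exists a permutation σ of {1, …, 5} such that λⱼ = μ_{σ(j)} for all j. -/

import Mathlib

theorem Multiset.eq_and_eq_of_cons_eq_cons_of_forall_le {α : Type*} [PartialOrder α]
    {x y : α} {s t : Multiset α} (hs : ∀ z ∈ s, x ≤ z) (ht : ∀ z ∈ t, y ≤ z)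
    (h : x ::ₘ s = y ::ₘ t) : x = y ∧ s = t := by
  have hxy : x = y := by
    have hx : x ∈ y ::ₘ t := h ▸ Multiset.mem_cons_self x s
    have hy : y ∈ x ::ₘ s := h ▸ Multiset.mem_cons_self y t
    rw [Multiset.mem_cons] at hx hy
    rcases hx with hx | hx
    · exact hx
    rcases hy with hy | hy
    · exact hy.symm
    exact le_antisymm (hs y hy) (ht x hx)
  subst hxy
  exact ⟨rfl, (Multiset.cons_inj_right x).1 h⟩

theorem Multiset.eq_and_eq_of_cons_eq_cons_of_forall_ge {α : Type*} [PartialOrder α]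
    {x y : α} {s t : Multiset α} (hs : ∀ z ∈ s, z ≤ x) (ht : ∀ z ∈ t, z ≤ y)
    (h : x ::ₘ s = y ::ₘ t) : x = y ∧ s = t :=
  Multiset.eq_and_eq_of_cons_eq_cons_of_forall_le (α := αᵒᵈ) hs ht h

/-- The sums over pairs `i < j` are the sums over the non-diagonal unordered pairs. -/
theorem map_pairSum_eq_map_sym2 {M : Type*} [AddCommMonoid M] (a : Fin 5 → M) :
    (((Finset.univ : Finset (Fin 5 × Fin 5)).filter fun p => p.1 < p.2).val.map
        fun p => a p.1 + a p.2) =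
      ((Finset.univ : Finset (Sym2 (Fin 5))).filter fun z => ¬ z.IsDiag).val.map
        (Sym2.lift ⟨fun i j => a i + a j, fun i j => add_comm (a i) (a j)⟩) := by
  have h : ((Finset.univ : Finset (Sym2 (Fin 5))).filter fun z => ¬ z.IsDiag).val =
      ((Finset.univ : Finset (Fin 5 × Fin 5)).filter fun p => p.1 < p.2).val.map
        fun p => s(p.1, p.2) := by
    decide
  rw [h, Multiset.map_map]
  rfl

theorem map_pairSum_comp_perm {M : Type*} [AddCommMonoid M] (a : Fin 5 → M)
    (σ : Equiv.Perm (Fin 5)) :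
    (((Finset.univ : Finset (Fin 5 × Fin 5)).filter fun p => p.1 < p.2).val.map
        fun p => (a ∘ σ) p.1 + (a ∘ σ) p.2) =
      (((Finset.univ : Finset (Fin 5 × Fin 5)).filter fun p => p.1 < p.2).val.map
        fun p => a p.1 + a p.2) := by
  rw [map_pairSum_eq_map_sym2, map_pairSum_eq_map_sym2]
  have h : ((Finset.univ : Finset (Sym2 (Fin 5))).filter fun z => ¬ z.IsDiag).map
      σ.toEmbedding.sym2Map =
      (Finset.univ : Finset (Sym2 (Fin 5))).filter fun z => ¬ z.IsDiag := by
    refine Finset.eq_of_subset_of_card_le (fun z hz => ?_) (Finset.card_map _).ge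
    obtain ⟨w, hw, rfl⟩ := Finset.mem_map.1 hz
    induction w with
    | _ i j => simpa using hw
  conv_rhs => rw [← h, Finset.map_val, Multiset.map_map]
  refine Multiset.map_congr rfl fun z _ => ?_
  induction z with
  | _ i j => rfl

/-- For a monotone 5-tuple the two smallest and the two largest pairwise sums sit at known
places, and together with the total they recover the tuple. -/
theorem eq_of_monotone_of_map_pairSum_eq {a b : Fin 5 → ℝ} (ha : Monotone a) (hb : Monotone b)
    (hsum : ∑ j, a j = ∑ j, b j)
    (h : (((Finset.univ : Finset (Fin 5 × Fin 5)).filter fun p => p.1 < p.2).val.map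
          fun p => a p.1 + a p.2) =
      (((Finset.univ : Finset (Fin 5 × Fin 5)).filter fun p => p.1 < p.2).val.map
          fun p => b p.1 + b p.2)) : a = b := by
  have hS : ((Finset.univ : Finset (Fin 5 × Fin 5)).filter fun p => p.1 < p.2).val =
      (0, 1) ::ₘ (0, 2) ::ₘ (3, 4) ::ₘ (2, 4) ::ₘ
        {(0, 3), (0, 4), (1, 2), (1, 3), (1, 4), (2, 3)} := by
    decide
  have mono : ∀ {c : Fin 5 → ℝ}, Monotone c →
      c 0 ≤ c 1 ∧ c 1 ≤ c 2 ∧ c 2 ≤ c 3 ∧ c 3 ≤ c 4 := fun hc =>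
    ⟨hc (by decide), hc (by decide), hc (by decide), hc (by decide)⟩
  obtain ⟨ha₀, ha₁, ha₂, ha₃⟩ := mono ha
  obtain ⟨hb₀, hb₁, hb₂, hb₃⟩ := mono hb
  rw [hS] at h
  simp only [Multiset.map_cons, Multiset.insert_eq_cons, Multiset.map_singleton] at h
  obtain ⟨h₀₁, h⟩ := Multiset.eq_and_eq_of_cons_eq_cons_of_forall_le
    (by simp only [Multiset.mem_cons, Multiset.mem_singleton, forall_eq_or_imp, forall_eq]
        refine ⟨?_, ?_, ?_, ?_, ?_, ?_, ?_, ?_, ?_⟩ <;> linarith)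
    (by simp only [Multiset.mem_cons, Multiset.mem_singleton, forall_eq_or_imp, forall_eq]
        refine ⟨?_, ?_, ?_, ?_, ?_, ?_, ?_, ?_, ?_⟩ <;> linarith) h
  obtain ⟨h₀₂, h⟩ := Multiset.eq_and_eq_of_cons_eq_cons_of_forall_le
    (by simp only [Multiset.mem_cons, Multiset.mem_singleton, forall_eq_or_imp, forall_eq]
        refine ⟨?_, ?_, ?_, ?_, ?_, ?_, ?_, ?_⟩ <;> linarith)
    (by simp only [Multiset.mem_cons, Multiset.mem_singleton, forall_eq_or_imp, forall_eq]
        refine ⟨?_, ?_, ?_, ?_, ?_, ?_, ?_, ?_⟩ <;> linarith) h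
  obtain ⟨h₃₄, h⟩ := Multiset.eq_and_eq_of_cons_eq_cons_of_forall_ge
    (by simp only [Multiset.mem_cons, Multiset.mem_singleton, forall_eq_or_imp, forall_eq]
        refine ⟨?_, ?_, ?_, ?_, ?_, ?_, ?_⟩ <;> linarith)
    (by simp only [Multiset.mem_cons, Multiset.mem_singleton, forall_eq_or_imp, forall_eq]
        refine ⟨?_, ?_, ?_, ?_, ?_, ?_, ?_⟩ <;> linarith) h
  obtain ⟨h₂₄, -⟩ := Multiset.eq_and_eq_of_cons_eq_cons_of_forall_ge
    (by simp only [Multiset.mem_cons, Multiset.mem_singleton, forall_eq_or_imp, forall_eq]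
        refine ⟨?_, ?_, ?_, ?_, ?_, ?_⟩ <;> linarith)
    (by simp only [Multiset.mem_cons, Multiset.mem_singleton, forall_eq_or_imp, forall_eq]
        refine ⟨?_, ?_, ?_, ?_, ?_, ?_⟩ <;> linarith) h
  simp only [Fin.sum_univ_five] at hsum
  ext j
  fin_cases j <;> simp only [Fin.reduceFinMk, Fin.zero_eta, Fin.mk_one] <;> linarith

theorem weight_determined_by_pairwise_sums_n5
    (μ lam : Fin 5 → ℝ)
    (hμ : ∀ j, 0 < μ j ∧ μ j < 1) (hlam : ∀ j, 0 < lam j ∧ lam j < 1)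
    (hμsum : ∑ j, μ j = 2) (hlamsum : ∑ j, lam j = 2)
    (hpairs :
      (((Finset.univ : Finset (Fin 5 × Fin 5)).filter fun p => p.1 < p.2).val.map
          fun p => μ p.1 + μ p.2) =
      (((Finset.univ : Finset (Fin 5 × Fin 5)).filter fun p => p.1 < p.2).val.map
          fun p => lam p.1 + lam p.2)) :
    ∃ σ : Equiv.Perm (Fin 5), ∀ j, lam j = μ (σ j) := by
  have h : μ ∘ Tuple.sort μ = lam ∘ Tuple.sort lam := by
    refine eq_of_monotone_of_map_pairSum_eq (Tuple.monotone_sort μ) (Tuple.monotone_sort lam) ?_ ?_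
    · simp only [Function.comp_apply, Equiv.sum_comp, hμsum, hlamsum]
    · rw [map_pairSum_comp_perm, map_pairSum_comp_perm, hpairs]
  refine ⟨(Tuple.sort lam).symm.trans (Tuple.sort μ), fun j => ?_⟩
  simpa using (congrFun h ((Tuple.sort lam).symm j)).symm
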